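/- Let u : ℝ² → ℝ be smooth and harmonic on the open half-plane {(ξ,η) : η > 0}, i.e. ∂²u/∂ξ² + ∂²u/∂η² = 0 there. Define U : ℝ⁴ → ℝ by U(x₀,x₁,x₂,x₃) = u(x₀, ‖(x₁,x₂,x₃)‖). Then U is biharmonic on the open set {x ∈ ℝ⁴ : (x₁,x₂,x₃) ≠ 0}, i.e. Δ(ΔU) = 0 there, where Δ is the Laplacian on ℝ⁴. -/

import Mathlib

/-- Directional (partial) derivative of a function on ℝ² in direction `d`. -/
noncomputable def pd2 (d : ℝ × ℝ) (u : ℝ × ℝ → ℝ) : ℝ × ℝ → ℝ :=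
  fun p => fderiv ℝ u p d

/-- The `i`-th partial derivative of `f : ℝ⁴ → ℝ`. -/
noncomputable def pd (i : Fin 4) (f : EuclideanSpace ℝ (Fin 4) → ℝ) :
    EuclideanSpace ℝ (Fin 4) → ℝ :=
  fun x => fderiv ℝ f x (EuclideanSpace.single i 1)

/-- The Laplacian of `f : ℝ⁴ → ℝ`. -/
noncomputable def laplacian (f : EuclideanSpace ℝ (Fin 4) → ℝ) :
    EuclideanSpace ℝ (Fin 4) → ℝ :=
  fun x => ∑ i : Fin 4, pd i (pd i f) x

open Set Filter Topology

/-- The open upper half-plane. -/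
def upperHalf : Set (ℝ × ℝ) := {p | 0 < p.2}

/-- The complement of the axis `x⃗ = 0` in ℝ⁴. -/
def offAxis : Set (EuclideanSpace ℝ (Fin 4)) := {x | 0 < x 1 ^ 2 + x 2 ^ 2 + x 3 ^ 2}

/-- The norm of the last three coordinates. -/
noncomputable def rad (x : EuclideanSpace ℝ (Fin 4)) : ℝ :=
  Real.sqrt (x 1 ^ 2 + x 2 ^ 2 + x 3 ^ 2)

/-- The cylindrical coordinates `(x₀, ‖x⃗‖)`. -/
noncomputable def cyl (x : EuclideanSpace ℝ (Fin 4)) : ℝ × ℝ := (x 0, rad x)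

lemma isOpen_upperHalf : IsOpen upperHalf := isOpen_lt continuous_const continuous_snd

lemma isOpen_offAxis : IsOpen offAxis := isOpen_lt continuous_const (by fun_prop)

lemma rad_pos {x : EuclideanSpace ℝ (Fin 4)} (hx : x ∈ offAxis) : 0 < rad x := Real.sqrt_pos.2 hx

lemma rad_sq {x : EuclideanSpace ℝ (Fin 4)} (hx : x ∈ offAxis) :
    rad x ^ 2 = x 1 ^ 2 + x 2 ^ 2 + x 3 ^ 2 := Real.sq_sqrt (le_of_lt hx)

lemma cyl_mem {x : EuclideanSpace ℝ (Fin 4)} (hx : x ∈ offAxis) : cyl x ∈ upperHalf := rad_pos hx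

lemma hasFDerivAt_coord (i : Fin 4) (x : EuclideanSpace ℝ (Fin 4)) :
    HasFDerivAt (fun y : EuclideanSpace ℝ (Fin 4) => y i)
      (EuclideanSpace.proj i : EuclideanSpace ℝ (Fin 4) →L[ℝ] ℝ) x :=
  (EuclideanSpace.proj i : EuclideanSpace ℝ (Fin 4) →L[ℝ] ℝ).hasFDerivAt

lemma hasFDerivAt_rad {x : EuclideanSpace ℝ (Fin 4)} (hx : x ∈ offAxis) :
    HasFDerivAt rad ((1 / rad x) • (x 1 • (EuclideanSpace.proj 1 :
      EuclideanSpace ℝ (Fin 4) →L[ℝ] ℝ) + x 2 • EuclideanSpace.proj 2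
        + x 3 • EuclideanSpace.proj 3)) x := by
  have h := ((((hasFDerivAt_coord 1 x).pow 2).add ((hasFDerivAt_coord 2 x).pow 2)).add
    ((hasFDerivAt_coord 3 x).pow 2)).sqrt (ne_of_gt hx)
  refine h.congr_fderiv ?_
  ext v
  have := rad_pos hx
  simp only [rad] at this ⊢
  simp
  field_simp

lemma hasFDerivAt_cyl {x : EuclideanSpace ℝ (Fin 4)} (hx : x ∈ offAxis) :
    HasFDerivAt cyl ((EuclideanSpace.proj 0 : EuclideanSpace ℝ (Fin 4) →L[ℝ] ℝ).prod
      ((1 / rad x) • (x 1 • (EuclideanSpace.proj 1 :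
      EuclideanSpace ℝ (Fin 4) →L[ℝ] ℝ) + x 2 • EuclideanSpace.proj 2
        + x 3 • EuclideanSpace.proj 3))) x :=
  (hasFDerivAt_coord 0 x).prodMk (hasFDerivAt_rad hx)

lemma pd_congr {f g : EuclideanSpace ℝ (Fin 4) → ℝ} (h : EqOn f g offAxis) (i : Fin 4) :
    EqOn (pd i f) (pd i g) offAxis := fun x hx => by
  simp only [pd, (h.eventuallyEq_of_mem (isOpen_offAxis.mem_nhds hx)).fderiv_eq]

lemma laplacian_congr {f g : EuclideanSpace ℝ (Fin 4) → ℝ} (h : EqOn f g offAxis) :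
    EqOn (laplacian f) (laplacian g) offAxis := fun x hx => by
  simp only [laplacian, pd_congr (pd_congr h _) _ hx]

lemma pd2_congr {f g : ℝ × ℝ → ℝ} (h : EqOn f g upperHalf) (d : ℝ × ℝ) :
    EqOn (pd2 d f) (pd2 d g) upperHalf := fun x hx => by
  simp only [pd2, (h.eventuallyEq_of_mem (isOpen_upperHalf.mem_nhds hx)).fderiv_eq]

lemma differentiableAt_of_smooth {g : ℝ × ℝ → ℝ} (hg : ContDiffOn ℝ (⊤ : ℕ∞) g upperHalf)
    {p : ℝ × ℝ} (hp : p ∈ upperHalf) : DifferentiableAt ℝ g p :=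
  (hg.contDiffAt (isOpen_upperHalf.mem_nhds hp)).differentiableAt (by simp)

lemma smooth_pd2 {g : ℝ × ℝ → ℝ} (hg : ContDiffOn ℝ (⊤ : ℕ∞) g upperHalf) (d : ℝ × ℝ) :
    ContDiffOn ℝ (⊤ : ℕ∞) (pd2 d g) upperHalf :=
  (hg.fderiv_of_isOpen isOpen_upperHalf (by simp)).clm_apply contDiffOn_const

lemma pd2_comm {g : ℝ × ℝ → ℝ} (hg : ContDiffOn ℝ (⊤ : ℕ∞) g upperHalf) (d e : ℝ × ℝ) :
    EqOn (pd2 d (pd2 e g)) (pd2 e (pd2 d g)) upperHalf := by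
  intro p hp
  have hc := hg.contDiffAt (isOpen_upperHalf.mem_nhds hp)
  have hs : IsSymmSndFDerivAt ℝ g p := hc.isSymmSndFDerivAt (by
    rw [minSmoothness_of_isRCLikeNormedField]; exact WithTop.coe_le_coe.2 (le_top (a := (2 : ℕ∞))))
  have hd : DifferentiableAt ℝ (fderiv ℝ g) p :=
    ((hg.fderiv_of_isOpen (m := (⊤ : ℕ∞)) isOpen_upperHalf (by simp)).contDiffAt
      (isOpen_upperHalf.mem_nhds hp)).differentiableAt (by simp)
  have key (a b : ℝ × ℝ) : pd2 a (pd2 b g) p = fderiv ℝ (fderiv ℝ g) p a b := by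
    have h := hd.hasFDerivAt.clm_apply (hasFDerivAt_const b p)
    have h' : fderiv ℝ (pd2 b g) p = _ := h.fderiv
    rw [pd2, h']
    simp
  rw [key, key, hs]

lemma pd_zero_comp_cyl {g : ℝ × ℝ → ℝ} (hg : ContDiffOn ℝ (⊤ : ℕ∞) g upperHalf) :
    EqOn (pd 0 (fun y => g (cyl y))) (fun y => pd2 (1, 0) g (cyl y)) offAxis := by
  intro x hx
  have h := (differentiableAt_of_smooth hg (cyl_mem hx)).hasFDerivAt.comp x (hasFDerivAt_cyl hx)
  have h' : fderiv ℝ (fun y => g (cyl y)) x = _ := h.fderiv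
  simp [pd, pd2, h']

lemma pd_comp_cyl {g : ℝ × ℝ → ℝ} (hg : ContDiffOn ℝ (⊤ : ℕ∞) g upperHalf)
    {i : Fin 4} (hi : i ≠ 0) :
    EqOn (pd i (fun y => g (cyl y))) (fun y => y i / rad y * pd2 (0, 1) g (cyl y)) offAxis := by
  intro x hx
  have h := (differentiableAt_of_smooth hg (cyl_mem hx)).hasFDerivAt.comp x (hasFDerivAt_cyl hx)
  have h' : fderiv ℝ (fun y => g (cyl y)) x = _ := h.fderiv
  have hsmul : ((0, x i / rad x) : ℝ × ℝ) = (x i / rad x) • ((0, 1) : ℝ × ℝ) := by simp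
  simp only [pd, pd2, h', ← smul_eq_mul, ← map_smul, ← hsmul, ContinuousLinearMap.comp_apply]
  congr 1
  fin_cases i <;> simp_all [div_eq_inv_mul]

lemma pd_coord_div_rad {i : Fin 4} (hi : i ≠ 0) {x : EuclideanSpace ℝ (Fin 4)}
    (hx : x ∈ offAxis) :
    pd i (fun y => y i / rad y) x = 1 / rad x - x i ^ 2 / rad x ^ 3 := by
  have hr := (rad_pos hx).ne'
  have h := (hasFDerivAt_coord i x).mul (((hasDerivAt_inv hr).comp_hasFDerivAt x
    (hasFDerivAt_rad hx)))
  have h' : fderiv ℝ (fun y => y i / rad y) x = _ := h.fderiv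
  simp only [pd, h']
  fin_cases i <;> simp_all <;> field_simp <;> ring

lemma differentiableAt_comp_cyl {g : ℝ × ℝ → ℝ} (hg : ContDiffOn ℝ (⊤ : ℕ∞) g upperHalf)
    {x : EuclideanSpace ℝ (Fin 4)} (hx : x ∈ offAxis) :
    DifferentiableAt ℝ (fun y => g (cyl y)) x :=
  ((differentiableAt_of_smooth hg (cyl_mem hx)).hasFDerivAt.comp x
    (hasFDerivAt_cyl hx)).differentiableAt

lemma pd_mul {f g : EuclideanSpace ℝ (Fin 4) → ℝ} {x : EuclideanSpace ℝ (Fin 4)}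
    (hf : DifferentiableAt ℝ f x) (hg : DifferentiableAt ℝ g x) (i : Fin 4) :
    pd i (fun y => f y * g y) x = f x * pd i g x + pd i f x * g x := by
  simp [pd, fderiv_fun_mul hf hg, mul_comm]

lemma pd2_mul {f g : ℝ × ℝ → ℝ} {p : ℝ × ℝ}
    (hf : DifferentiableAt ℝ f p) (hg : DifferentiableAt ℝ g p) (d : ℝ × ℝ) :
    pd2 d (fun q => f q * g q) p = f p * pd2 d g p + pd2 d f p * g p := by
  simp [pd2, fderiv_fun_mul hf hg, mul_comm]

lemma pd2_add {f g : ℝ × ℝ → ℝ} {p : ℝ × ℝ}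
    (hf : DifferentiableAt ℝ f p) (hg : DifferentiableAt ℝ g p) (d : ℝ × ℝ) :
    pd2 d (fun q => f q + g q) p = pd2 d f p + pd2 d g p := by
  simp [pd2, fderiv_fun_add hf hg]

lemma pd_pd_comp_cyl {g : ℝ × ℝ → ℝ} (hg : ContDiffOn ℝ (⊤ : ℕ∞) g upperHalf)
    {i : Fin 4} (hi : i ≠ 0) {x : EuclideanSpace ℝ (Fin 4)} (hx : x ∈ offAxis) :
    pd i (pd i (fun y => g (cyl y))) x =
      x i ^ 2 / rad x ^ 2 * pd2 (0, 1) (pd2 (0, 1) g) (cyl x)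
        + (1 / rad x - x i ^ 2 / rad x ^ 3) * pd2 (0, 1) g (cyl x) := by
  have hs := smooth_pd2 hg (0, 1)
  have hd : DifferentiableAt ℝ (fun y : EuclideanSpace ℝ (Fin 4) => y i / rad y) x :=
    (hasFDerivAt_coord i x).differentiableAt.mul
      ((hasFDerivAt_rad hx).differentiableAt.inv (rad_pos hx).ne')
  rw [pd_congr (pd_comp_cyl hg hi) i hx, pd_mul hd (differentiableAt_comp_cyl hs hx),
    pd_comp_cyl hs hi hx, pd_coord_div_rad hi hx]
  ring

/-- The Laplacian on ℝ⁴ in cylindrical coordinates. -/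
lemma laplacian_comp_cyl {g : ℝ × ℝ → ℝ} (hg : ContDiffOn ℝ (⊤ : ℕ∞) g upperHalf)
    {x : EuclideanSpace ℝ (Fin 4)} (hx : x ∈ offAxis) :
    laplacian (fun y => g (cyl y)) x =
      pd2 (1, 0) (pd2 (1, 0) g) (cyl x) + pd2 (0, 1) (pd2 (0, 1) g) (cyl x)
        + 2 / rad x * pd2 (0, 1) g (cyl x) := by
  have hr := (rad_pos hx).ne'
  rw [laplacian, Fin.sum_univ_four, pd_congr (pd_zero_comp_cyl hg) 0 hx,
    pd_zero_comp_cyl (smooth_pd2 hg _) hx, pd_pd_comp_cyl hg (by decide) hx,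
    pd_pd_comp_cyl hg (by decide) hx, pd_pd_comp_cyl hg (by decide) hx]
  have h1 : x 1 ^ 2 = rad x ^ 2 - x 2 ^ 2 - x 3 ^ 2 := by rw [rad_sq hx]; ring
  rw [h1]
  field_simp
  ring

lemma contDiffOn_two_div_snd :
    ContDiffOn ℝ (⊤ : ℕ∞) (fun p : ℝ × ℝ => 2 / p.2) upperHalf :=
  contDiffOn_const.div contDiffOn_snd fun _ hp => ne_of_gt hp

lemma pd2_const_div_snd_pow (c : ℝ) (n : ℕ) (d : ℝ × ℝ) {p : ℝ × ℝ} (hp : p ∈ upperHalf) :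
    pd2 d (fun q => c / q.2 ^ n) p = -(n * c * d.2) / p.2 ^ (n + 1) := by
  have hp' : p.2 ≠ 0 := ne_of_gt hp
  have h := ((hasDerivAt_const p.2 c).div (hasDerivAt_pow n p.2)
    (pow_ne_zero n hp')).comp_hasFDerivAt p (hasFDerivAt_snd (𝕜 := ℝ))
  have h' : fderiv ℝ (fun q : ℝ × ℝ => c / q.2 ^ n) p = _ := h.fderiv
  rw [pd2, h']
  rcases n with _ | n
  · simp
  · simp
    field_simp
    ring

lemma harmonic_pd2 {u : ℝ × ℝ → ℝ} (hu : ContDiffOn ℝ (⊤ : ℕ∞) u upperHalf)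
    (hharm : ∀ p ∈ upperHalf, pd2 (1, 0) (pd2 (1, 0) u) p + pd2 (0, 1) (pd2 (0, 1) u) p = 0)
    (d : ℝ × ℝ) {p : ℝ × ℝ} (hp : p ∈ upperHalf) :
    pd2 (1, 0) (pd2 (1, 0) (pd2 d u)) p + pd2 (0, 1) (pd2 (0, 1) (pd2 d u)) p = 0 := by
  have key (e : ℝ × ℝ) : pd2 e (pd2 e (pd2 d u)) p = pd2 d (pd2 e (pd2 e u)) p := by
    rw [pd2_congr (pd2_comm hu e d) e hp, pd2_comm (smooth_pd2 hu e) e d hp]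
  have hdiff (e : ℝ × ℝ) : DifferentiableAt ℝ (pd2 e (pd2 e u)) p :=
    differentiableAt_of_smooth (smooth_pd2 (smooth_pd2 hu e) e) hp
  rw [key, key, ← pd2_add (hdiff _) (hdiff _), pd2_congr (g := fun _ => 0) hharm d hp]
  simp [pd2]

/-- If `w` is harmonic, then `2 w / η` is annihilated by the cylindrical Laplacian. -/
lemma cylindrical_laplacian_two_div_mul {w : ℝ × ℝ → ℝ}
    (hw : ContDiffOn ℝ (⊤ : ℕ∞) w upperHalf) {p : ℝ × ℝ} (hp : p ∈ upperHalf)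
    (hharm : pd2 (1, 0) (pd2 (1, 0) w) p + pd2 (0, 1) (pd2 (0, 1) w) p = 0) :
    pd2 (1, 0) (pd2 (1, 0) (fun q => 2 / q.2 * w q)) p
      + pd2 (0, 1) (pd2 (0, 1) (fun q => 2 / q.2 * w q)) p
      + 2 / p.2 * pd2 (0, 1) (fun q => 2 / q.2 * w q) p = 0 := by
  have hp' : p.2 ≠ 0 := ne_of_gt hp
  have hd (c : ℝ) (n : ℕ) {q : ℝ × ℝ} (hq : q ∈ upperHalf) :
      DifferentiableAt ℝ (fun q : ℝ × ℝ => c / q.2 ^ n) q :=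
    (differentiableAt_const c).mul
      ((differentiableAt_snd.pow n).inv (pow_ne_zero n (ne_of_gt hq)))
  have first (d : ℝ × ℝ) : EqOn (pd2 d (fun q => 2 / q.2 * w q))
      (fun q => 2 / q.2 ^ 1 * pd2 d w q + -(2 * d.2) / q.2 ^ 2 * w q) upperHalf := by
    intro q hq
    have h := pd2_mul (hd 2 1 hq) (differentiableAt_of_smooth hw hq) d
    rw [pd2_const_div_snd_pow 2 1 d hq] at h
    simpa using h
  have second (d : ℝ × ℝ) : pd2 d (pd2 d (fun q => 2 / q.2 * w q)) p =
      2 / p.2 * pd2 d (pd2 d w) p - 4 * d.2 / p.2 ^ 2 * pd2 d w p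
        + 4 * d.2 ^ 2 / p.2 ^ 3 * w p := by
    have hw1 := differentiableAt_of_smooth hw hp
    have hw2 := differentiableAt_of_smooth (smooth_pd2 hw d) hp
    rw [pd2_congr (first d) d hp, pd2_add ((hd _ _ hp).fun_mul hw2) ((hd _ _ hp).fun_mul hw1),
      pd2_mul (hd _ _ hp) hw2, pd2_mul (hd _ _ hp) hw1,
      pd2_const_div_snd_pow _ _ _ hp, pd2_const_div_snd_pow _ _ _ hp]
    push_cast
    field_simp
    ring
  rw [second, second, first _ hp, eq_neg_of_add_eq_zero_left hharm]
  field_simp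
  ring

/-- Lemma 1 of the paper: if `u(ξ,η)` is harmonic on the upper half-plane, then
`U(x) = u(x₀, ‖x⃗‖)` is biharmonic away from `x⃗ = 0`. -/
theorem biharmonic_of_harmonic (u : ℝ × ℝ → ℝ)
    (hu : ContDiffOn ℝ (⊤ : ℕ∞) u {p : ℝ × ℝ | 0 < p.2})
    (hharm : ∀ p : ℝ × ℝ, 0 < p.2 →
      pd2 (1, 0) (pd2 (1, 0) u) p + pd2 (0, 1) (pd2 (0, 1) u) p = 0) :
    ∀ x : EuclideanSpace ℝ (Fin 4), ¬(x 1 = 0 ∧ x 2 = 0 ∧ x 3 = 0) →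
      laplacian (laplacian
        (fun y => u (y 0, Real.sqrt ((y 1) ^ 2 + (y 2) ^ 2 + (y 3) ^ 2)))) x = 0 := by
  intro x hx
  have hx' : x ∈ offAxis := by
    by_contra h
    have h : x 1 ^ 2 + x 2 ^ 2 + x 3 ^ 2 ≤ 0 := not_lt.1 h
    exact hx ⟨by nlinarith [sq_nonneg (x 1), sq_nonneg (x 2), sq_nonneg (x 3)],
      by nlinarith [sq_nonneg (x 1), sq_nonneg (x 2), sq_nonneg (x 3)],
      by nlinarith [sq_nonneg (x 1), sq_nonneg (x 2), sq_nonneg (x 3)]⟩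
  have hlap : EqOn (laplacian (fun y => u (cyl y)))
      (fun y => (fun q : ℝ × ℝ => 2 / q.2 * pd2 (0, 1) u q) (cyl y)) offAxis := fun y hy => by
    rw [laplacian_comp_cyl hu hy, hharm _ (cyl_mem hy), zero_add]
    rfl
  have hw := smooth_pd2 hu (0, 1)
  change laplacian (laplacian (fun y => u (cyl y))) x = 0
  rw [laplacian_congr hlap hx', laplacian_comp_cyl (contDiffOn_two_div_snd.mul hw) hx']
  exact cylindrical_laplacian_two_div_mul hw (cyl_mem hx')
    (harmonic_pd2 hu hharm (0, 1) (cyl_mem hx'))
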